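/- Every ontology-mediated atomic query q = (O, A), where O is an LTL_bool^□ ontology and A an atomic concept, is FO(<)-rewritable: there is a constant-free FO(<)-formula q(t) with one free variable t such that ans(q, A) = {ℓ ∈ tem(A) : S_A ⊨ q(ℓ)} for every data instance A. -/

import Mathlib

namespace LTLOMQ

/-! ## Temporal concepts (LTL formulas) and their semantics over (ℤ,<) -/

/-- Temporal concepts: arbitrary LTL formulas over atomic concepts indexed by `ℕ`. -/
inductive TC : Type where
  | top : TC
  | atom : ℕ → TC
  | neg : TC → TC
  | and : TC → TC → TC
  | or : TC → TC → TC
  | nextF : TC → TC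
  | diamF : TC → TC
  | boxF : TC → TC
  | untl : TC → TC → TC
  | nextP : TC → TC
  | diamP : TC → TC
  | boxP : TC → TC
  | since : TC → TC → TC

/-- A temporal interpretation assigns to each atomic concept a subset of ℤ. -/
abbrev Itp : Type := ℕ → Set ℤ

/-- The extension of a temporal concept in an interpretation
(strict semantics over `(ℤ,<)`). -/
def TC.sem (M : Itp) : TC → Set ℤ
  | .top => Set.univ
  | .atom a => M a
  | .neg C => (TC.sem M C)ᶜ
  | .and C D => TC.sem M C ∩ TC.sem M D
  | .or C D => TC.sem M C ∪ TC.sem M D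
  | .nextF C => {n | n + 1 ∈ TC.sem M C}
  | .diamF C => {n | ∃ k, n < k ∧ k ∈ TC.sem M C}
  | .boxF C => {n | ∀ k, n < k → k ∈ TC.sem M C}
  | .untl C D => {n | ∃ k, n < k ∧ k ∈ TC.sem M D ∧ ∀ m, n < m → m < k → m ∈ TC.sem M C}
  | .nextP C => {n | n - 1 ∈ TC.sem M C}
  | .diamP C => {n | ∃ k, k < n ∧ k ∈ TC.sem M C}
  | .boxP C => {n | ∀ k, k < n → k ∈ TC.sem M C}
  | .since C D => {n | ∃ k, k < n ∧ k ∈ TC.sem M D ∧ ∀ m, k < m → m < n → m ∈ TC.sem M C}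

/-- Basic temporal concepts: built from atomic concepts using ○F, ○P, □F, □P. -/
inductive TC.IsBasic : TC → Prop
  | atom (a : ℕ) : TC.IsBasic (.atom a)
  | nextF {C : TC} : TC.IsBasic C → TC.IsBasic (.nextF C)
  | nextP {C : TC} : TC.IsBasic C → TC.IsBasic (.nextP C)
  | boxF {C : TC} : TC.IsBasic C → TC.IsBasic (.boxF C)
  | boxP {C : TC} : TC.IsBasic C → TC.IsBasic (.boxP C)

/-- Basic temporal concepts using □F and □P only. -/
inductive TC.IsBasicBox : TC → Prop
  | atom (a : ℕ) : TC.IsBasicBox (.atom a)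
  | boxF {C : TC} : TC.IsBasicBox C → TC.IsBasicBox (.boxF C)
  | boxP {C : TC} : TC.IsBasicBox C → TC.IsBasicBox (.boxP C)

/-- Basic temporal concepts using ○F and ○P only. -/
inductive TC.IsBasicNext : TC → Prop
  | atom (a : ℕ) : TC.IsBasicNext (.atom a)
  | nextF {C : TC} : TC.IsBasicNext C → TC.IsBasicNext (.nextF C)
  | nextP {C : TC} : TC.IsBasicNext C → TC.IsBasicNext (.nextP C)

/-- Positive temporal concepts: no occurrences of ¬. -/
inductive TC.IsPositive : TC → Prop
  | top : TC.IsPositive .top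
  | atom (a : ℕ) : TC.IsPositive (.atom a)
  | and {C D : TC} : TC.IsPositive C → TC.IsPositive D → TC.IsPositive (.and C D)
  | or {C D : TC} : TC.IsPositive C → TC.IsPositive D → TC.IsPositive (.or C D)
  | nextF {C : TC} : TC.IsPositive C → TC.IsPositive (.nextF C)
  | diamF {C : TC} : TC.IsPositive C → TC.IsPositive (.diamF C)
  | boxF {C : TC} : TC.IsPositive C → TC.IsPositive (.boxF C)
  | untl {C D : TC} : TC.IsPositive C → TC.IsPositive D → TC.IsPositive (.untl C D)
  | nextP {C : TC} : TC.IsPositive C → TC.IsPositive (.nextP C)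
  | diamP {C : TC} : TC.IsPositive C → TC.IsPositive (.diamP C)
  | boxP {C : TC} : TC.IsPositive C → TC.IsPositive (.boxP C)
  | since {C D : TC} : TC.IsPositive C → TC.IsPositive D → TC.IsPositive (.since C D)

/-- Prior-LTL formulas: Boolean connectives and □P, ◇P, □F, ◇F only. -/
inductive TC.IsPrior : TC → Prop
  | atom (a : ℕ) : TC.IsPrior (.atom a)
  | neg {C : TC} : TC.IsPrior C → TC.IsPrior (.neg C)
  | and {C D : TC} : TC.IsPrior C → TC.IsPrior D → TC.IsPrior (.and C D)
  | or {C D : TC} : TC.IsPrior C → TC.IsPrior D → TC.IsPrior (.or C D)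
  | boxF {C : TC} : TC.IsPrior C → TC.IsPrior (.boxF C)
  | boxP {C : TC} : TC.IsPrior C → TC.IsPrior (.boxP C)
  | diamF {C : TC} : TC.IsPrior C → TC.IsPrior (.diamF C)
  | diamP {C : TC} : TC.IsPrior C → TC.IsPrior (.diamP C)

/-- Number of occurrences of temporal operators in a temporal concept. -/
def TC.tempOps : TC → ℕ
  | .top => 0
  | .atom _ => 0
  | .neg C => TC.tempOps C
  | .and C D => TC.tempOps C + TC.tempOps D
  | .or C D => TC.tempOps C + TC.tempOps D
  | .nextF C => TC.tempOps C + 1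
  | .diamF C => TC.tempOps C + 1
  | .boxF C => TC.tempOps C + 1
  | .untl C D => TC.tempOps C + TC.tempOps D + 1
  | .nextP C => TC.tempOps C + 1
  | .diamP C => TC.tempOps C + 1
  | .boxP C => TC.tempOps C + 1
  | .since C D => TC.tempOps C + TC.tempOps D + 1

/-- Number of occurrences of symbols in a temporal concept. -/
def TC.size : TC → ℕ
  | .top => 1
  | .atom _ => 1
  | .neg C => TC.size C + 1
  | .and C D => TC.size C + TC.size D + 1
  | .or C D => TC.size C + TC.size D + 1
  | .nextF C => TC.size C + 1
  | .diamF C => TC.size C + 1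
  | .boxF C => TC.size C + 1
  | .untl C D => TC.size C + TC.size D + 1
  | .nextP C => TC.size C + 1
  | .diamP C => TC.size C + 1
  | .boxP C => TC.size C + 1
  | .since C D => TC.size C + TC.size D + 1

/-- The set of subconcepts of a temporal concept. -/
def TC.subs : TC → Set TC
  | .top => {.top}
  | .atom a => {.atom a}
  | .neg C => insert (.neg C) (TC.subs C)
  | .and C D => insert (.and C D) (TC.subs C ∪ TC.subs D)
  | .or C D => insert (.or C D) (TC.subs C ∪ TC.subs D)
  | .nextF C => insert (.nextF C) (TC.subs C)
  | .diamF C => insert (.diamF C) (TC.subs C)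
  | .boxF C => insert (.boxF C) (TC.subs C)
  | .untl C D => insert (.untl C D) (TC.subs C ∪ TC.subs D)
  | .nextP C => insert (.nextP C) (TC.subs C)
  | .diamP C => insert (.diamP C) (TC.subs C)
  | .boxP C => insert (.boxP C) (TC.subs C)
  | .since C D => insert (.since C D) (TC.subs C ∪ TC.subs D)

/-- The set of atomic concepts occurring in a temporal concept. -/
def TC.atoms : TC → Set ℕ
  | .top => ∅
  | .atom a => {a}
  | .neg C => TC.atoms C
  | .and C D => TC.atoms C ∪ TC.atoms D
  | .or C D => TC.atoms C ∪ TC.atoms D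
  | .nextF C => TC.atoms C
  | .diamF C => TC.atoms C
  | .boxF C => TC.atoms C
  | .untl C D => TC.atoms C ∪ TC.atoms D
  | .nextP C => TC.atoms C
  | .diamP C => TC.atoms C
  | .boxP C => TC.atoms C
  | .since C D => TC.atoms C ∪ TC.atoms D

/-! ## Clauses, ontologies, data instances -/

/-- A clause `C₁ ∧ … ∧ C_k → C_{k+1} ∨ … ∨ C_{k+m}`. -/
structure Clause : Type where
  prem : List TC
  concl : List TC

/-- A clause is true in `M` if the intersection of the extensions of the premises
is contained in the union of the extensions of the conclusions. -/
def Clause.holds (M : Itp) (cl : Clause) : Prop :=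
  ∀ n : ℤ, (∀ C ∈ cl.prem, n ∈ TC.sem M C) → ∃ C ∈ cl.concl, n ∈ TC.sem M C

/-- An ontology is a finite set (list) of clauses. -/
abbrev Ontology : Type := List Clause

def Clause.AllBasic (cl : Clause) : Prop :=
  (∀ C ∈ cl.prem, C.IsBasic) ∧ (∀ C ∈ cl.concl, C.IsBasic)

def Clause.AllBasicBox (cl : Clause) : Prop :=
  (∀ C ∈ cl.prem, C.IsBasicBox) ∧ (∀ C ∈ cl.concl, C.IsBasicBox)

def Clause.AllBasicNext (cl : Clause) : Prop :=
  (∀ C ∈ cl.prem, C.IsBasicNext) ∧ (∀ C ∈ cl.concl, C.IsBasicNext)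

/-- Horn: at most one disjunct in the conclusion. -/
def Clause.Horn (cl : Clause) : Prop := cl.concl.length ≤ 1

/-- Krom (binary): at most two concepts altogether. -/
def Clause.Krom (cl : Clause) : Prop := cl.prem.length + cl.concl.length ≤ 2

/-- LTL_bool^□○ ontologies. -/
def Ontology.BoolBoxNext (O : Ontology) : Prop := ∀ cl ∈ O, cl.AllBasic
/-- LTL_bool^□ ontologies. -/
def Ontology.BoolBox (O : Ontology) : Prop := ∀ cl ∈ O, cl.AllBasicBox
/-- LTL_krom^○ ontologies. -/
def Ontology.KromNext (O : Ontology) : Prop := ∀ cl ∈ O, cl.AllBasicNext ∧ cl.Krom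
/-- LTL_krom^□○ ontologies. -/
def Ontology.KromBoxNext (O : Ontology) : Prop := ∀ cl ∈ O, cl.AllBasic ∧ cl.Krom
/-- LTL_horn^□○ ontologies. -/
def Ontology.HornBoxNext (O : Ontology) : Prop := ∀ cl ∈ O, cl.AllBasic ∧ cl.Horn
/-- LTL_horn^□ ontologies. -/
def Ontology.HornBox (O : Ontology) : Prop := ∀ cl ∈ O, cl.AllBasicBox ∧ cl.Horn
/-- LTL_core^□○ ontologies. -/
def Ontology.CoreBoxNext (O : Ontology) : Prop := ∀ cl ∈ O, cl.AllBasic ∧ cl.Horn ∧ cl.Krom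

/-- Number of occurrences of symbols in a clause. -/
def Clause.size (cl : Clause) : ℕ :=
  (cl.prem.map TC.size).sum + (cl.concl.map TC.size).sum + 1

/-- Number of occurrences of symbols in an ontology. -/
def Ontology.size (O : Ontology) : ℕ := (O.map Clause.size).sum

/-- The atomic concept `a` occurs in the ontology `O`. -/
def Ontology.occurs (O : Ontology) (a : ℕ) : Prop :=
  ∃ cl ∈ O, (∃ C ∈ cl.prem, a ∈ C.atoms) ∨ (∃ C ∈ cl.concl, a ∈ C.atoms)

/-- The set of subconcepts of (concepts occurring in) an ontology. -/
def Ontology.subs (O : Ontology) : Set TC :=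
  {C | ∃ cl ∈ O, ∃ D : TC, (D ∈ cl.prem ∨ D ∈ cl.concl) ∧ C ∈ D.subs}

/-- A flat concept: an atomic concept, or a single ○F or ○P applied to an atomic concept. -/
def TC.IsFlat : TC → Prop
  | .atom _ => True
  | .nextF (.atom _) => True
  | .nextP (.atom _) => True
  | _ => False

/-- An ontology without nested temporal operators. -/
def Ontology.Flat (O : Ontology) : Prop :=
  ∀ cl ∈ O, (∀ C ∈ cl.prem, C.IsFlat) ∧ (∀ C ∈ cl.concl, C.IsFlat)

/-- A data instance: a finite nonempty set of timestamped atoms, normalized so that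
the minimal timestamp is 0 and the maximal one is ≥ 1. -/
structure DataInstance : Type where
  atoms : Finset (ℕ × ℤ)
  nonneg : ∀ p ∈ atoms, 0 ≤ p.2
  has_zero : ∃ p ∈ atoms, p.2 = 0
  has_one : ∃ p ∈ atoms, 1 ≤ p.2

theorem DataInstance.ts_nonempty (A : DataInstance) :
    (A.atoms.image Prod.snd).Nonempty := by
  obtain ⟨p, hp, -⟩ := A.has_zero
  exact ⟨p.2, Finset.mem_image_of_mem _ hp⟩

/-- min A: the minimal timestamp occurring in the data instance (equal to 0). -/
def DataInstance.minT (A : DataInstance) : ℤ :=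
  (A.atoms.image Prod.snd).min' A.ts_nonempty

/-- max A: the maximal timestamp occurring in the data instance. -/
def DataInstance.maxT (A : DataInstance) : ℤ :=
  (A.atoms.image Prod.snd).max' A.ts_nonempty

/-- The active temporal domain tem(A). -/
def DataInstance.tem (A : DataInstance) : Set ℤ := Set.Icc A.minT A.maxT

/-- The interpretation of atomic concepts in the first-order structure S_A. -/
def DataInstance.itp (A : DataInstance) : Itp := fun a => {n | (a, n) ∈ A.atoms}

/-- `M` is a model of the knowledge base `(O, A)`. -/
def IsModel (M : Itp) (O : Ontology) (A : DataInstance) : Prop :=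
  (∀ cl ∈ O, cl.holds M) ∧ ∀ p ∈ A.atoms, p.2 ∈ M p.1

/-- The ontology `O` is consistent. -/
def Ontology.Consistent (O : Ontology) : Prop := ∃ M : Itp, ∀ cl ∈ O, cl.holds M

/-- The data instance `A` is consistent with `O`. -/
def ConsistentWith (O : Ontology) (A : DataInstance) : Prop := ∃ M : Itp, IsModel M O A

/-- Certain answers to the OMIQ `(O, κ)` over `A` (within the active domain). -/
def certAns (O : Ontology) (κ : TC) (A : DataInstance) : Set ℤ :=
  {ℓ | ℓ ∈ A.tem ∧ ∀ M : Itp, IsModel M O A → ℓ ∈ TC.sem M κ}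

/-- Certain answers to the OMIQ `(O, κ)` over `A` and ℤ. -/
def certAnsZ (O : Ontology) (κ : TC) (A : DataInstance) : Set ℤ :=
  {ℓ | ∀ M : Itp, IsModel M O A → ℓ ∈ TC.sem M κ}

/-! ## First-order, MSO and FO(RPR) formulas over the temporal structures -/

/-- Formulas of the target languages: first-order variables are indexed by `ℕ`,
as are second-order (set) variables and the recursively defined relation variables
of FO(RPR).  The constructors `qprev j` and `qapp j x` stand for `Q_j(t-1)` (inside
a recursive definition block) and `Q_j(x)`, respectively; `rpr n Θ tv ψ` is the
relational-primitive-recursion construct `[Q₁(t) ≡ Θ₁; …; Q_n(t) ≡ Θ_n] ψ`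
with recursion variable `tv`. -/
inductive Fml : Type where
  | falsum : Fml
  | atom : ℕ → ℕ → Fml        -- A(x)
  | lt : ℕ → ℕ → Fml          -- x < y
  | eq : ℕ → ℕ → Fml          -- x = y
  | succ : ℕ → ℕ → Fml        -- x = y + 1
  | mod : ℕ → ℕ → Fml         -- x ≡ 0 (mod n)
  | svar : ℕ → ℕ → Fml        -- X(x), X a set variable
  | qprev : ℕ → Fml           -- Q_j(t−1)
  | qapp : ℕ → ℕ → Fml        -- Q_j(x)
  | neg : Fml → Fml
  | and : Fml → Fml → Fml
  | or : Fml → Fml → Fml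
  | ex : ℕ → Fml → Fml
  | all : ℕ → Fml → Fml
  | exS : ℕ → Fml → Fml       -- second-order ∃
  | allS : ℕ → Fml → Fml      -- second-order ∀
  | rpr : (n : ℕ) → (Fin n → Fml) → ℕ → Fml → Fml

/-- Evaluation of a formula over the structure with (active) domain `D ⊆ ℤ`
and interpretation `I` of the unary predicates; `env` assigns first-order
variables, `senv` set variables, `prev` the placeholders `Q_j(t-1)` and
`Q` the defined relation variables. First-order quantifiers range over `D`,
second-order quantifiers over subsets of `D`. -/
def Fml.eval (D : Set ℤ) (I : ℕ → Set ℤ) :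
    Fml → (ℕ → ℤ) → (ℕ → Set ℤ) → (ℕ → Prop) → (ℕ → ℤ → Prop) → Prop
  | .falsum, _, _, _, _ => False
  | .atom a x, env, _, _, _ => env x ∈ I a
  | .lt x y, env, _, _, _ => env x < env y
  | .eq x y, env, _, _, _ => env x = env y
  | .succ x y, env, _, _, _ => env x = env y + 1
  | .mod n x, env, _, _, _ => (n : ℤ) ∣ env x
  | .svar X x, env, senv, _, _ => env x ∈ senv X
  | .qprev j, _, _, prev, _ => prev j
  | .qapp j x, env, _, _, Q => Q j (env x)
  | .neg φ, env, senv, prev, Q => ¬ Fml.eval D I φ env senv prev Q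
  | .and φ ψ, env, senv, prev, Q =>
      Fml.eval D I φ env senv prev Q ∧ Fml.eval D I ψ env senv prev Q
  | .or φ ψ, env, senv, prev, Q =>
      Fml.eval D I φ env senv prev Q ∨ Fml.eval D I ψ env senv prev Q
  | .ex x φ, env, senv, prev, Q =>
      ∃ d ∈ D, Fml.eval D I φ (Function.update env x d) senv prev Q
  | .all x φ, env, senv, prev, Q =>
      ∀ d ∈ D, Fml.eval D I φ (Function.update env x d) senv prev Q
  | .exS X φ, env, senv, prev, Q =>
      ∃ S : Set ℤ, S ⊆ D ∧ Fml.eval D I φ env (Function.update senv X S) prev Q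
  | .allS X φ, env, senv, prev, Q =>
      ∀ S : Set ℤ, S ⊆ D → Fml.eval D I φ env (Function.update senv X S) prev Q
  | .rpr n Θ tv ψ, env, senv, prev, Q =>
      -- the semantics of each Θ_j, as a function of the first-order environment
      -- and of the truth values of the `Q_j(t−1)` placeholders
      let f : Fin n → (ℕ → ℤ) → (ℕ → Prop) → Prop :=
        fun j env' prev' => Fml.eval D I (Θ j) env' senv prev' Q
      -- the recursively computed truth values of `Q_j` at time `k` (recursion on k from 0)
      let recQ : ℕ → Fin n → Prop := fun k =>
        Nat.rec (fun j => f j (Function.update env tv 0) (fun _ => False))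
          (fun m ih j => f j (Function.update env tv ((m : ℤ) + 1))
            (fun i => ∃ h : i < n, ih ⟨i, h⟩)) k
      Fml.eval D I ψ env senv prev
        (fun j z => ∃ h : j < n, 0 ≤ z ∧ recQ z.toNat ⟨j, h⟩)

/-- Free first-order variables of a formula. -/
def Fml.fvars : Fml → Set ℕ
  | .falsum => ∅
  | .atom _ x => {x}
  | .lt x y => {x, y}
  | .eq x y => {x, y}
  | .succ x y => {x, y}
  | .mod _ x => {x}
  | .svar _ x => {x}
  | .qprev _ => ∅
  | .qapp _ x => {x}
  | .neg φ => Fml.fvars φ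
  | .and φ ψ => Fml.fvars φ ∪ Fml.fvars ψ
  | .or φ ψ => Fml.fvars φ ∪ Fml.fvars ψ
  | .ex x φ => Fml.fvars φ \ {x}
  | .all x φ => Fml.fvars φ \ {x}
  | .exS _ φ => Fml.fvars φ
  | .allS _ φ => Fml.fvars φ
  | .rpr n Θ tv ψ => (⋃ j : Fin n, Fml.fvars (Θ j) \ {tv}) ∪ Fml.fvars ψ

/-- FO(<)-formulas: first-order logic with the built-in linear order
(and the definable equality predicate); no constants, no arithmetic. -/
def Fml.IsFOlt : Fml → Prop
  | .falsum => True
  | .atom _ _ => True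
  | .lt _ _ => True
  | .eq _ _ => True
  | .neg φ => Fml.IsFOlt φ
  | .and φ ψ => Fml.IsFOlt φ ∧ Fml.IsFOlt ψ
  | .or φ ψ => Fml.IsFOlt φ ∧ Fml.IsFOlt ψ
  | .ex _ φ => Fml.IsFOlt φ
  | .all _ φ => Fml.IsFOlt φ
  | _ => False

/-- FO(<,≡)-formulas: FO(<) extended with the predicates `t ≡ 0 (mod n)`, `n > 1`. -/
def Fml.IsFOltMod : Fml → Prop
  | .falsum => True
  | .atom _ _ => True
  | .lt _ _ => True
  | .eq _ _ => True
  | .mod n _ => 2 ≤ n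
  | .neg φ => Fml.IsFOltMod φ
  | .and φ ψ => Fml.IsFOltMod φ ∧ Fml.IsFOltMod ψ
  | .or φ ψ => Fml.IsFOltMod φ ∧ Fml.IsFOltMod ψ
  | .ex _ φ => Fml.IsFOltMod φ
  | .all _ φ => Fml.IsFOltMod φ
  | _ => False

/-- MSO(<)-formulas: FO(<) extended with set variables and second-order quantifiers. -/
def Fml.IsMSO : Fml → Prop
  | .falsum => True
  | .atom _ _ => True
  | .lt _ _ => True
  | .eq _ _ => True
  | .svar _ _ => True
  | .neg φ => Fml.IsMSO φ
  | .and φ ψ => Fml.IsMSO φ ∧ Fml.IsMSO ψ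
  | .or φ ψ => Fml.IsMSO φ ∧ Fml.IsMSO ψ
  | .ex _ φ => Fml.IsMSO φ
  | .all _ φ => Fml.IsMSO φ
  | .exS _ φ => Fml.IsMSO φ
  | .allS _ φ => Fml.IsMSO φ
  | _ => False

/-- FO(RPR)-formulas: FO(<) extended with successor and relational primitive recursion. -/
def Fml.IsRPR : Fml → Prop
  | .falsum => True
  | .atom _ _ => True
  | .lt _ _ => True
  | .eq _ _ => True
  | .succ _ _ => True
  | .qprev _ => True
  | .qapp _ _ => True
  | .neg φ => Fml.IsRPR φ
  | .and φ ψ => Fml.IsRPR φ ∧ Fml.IsRPR ψ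
  | .or φ ψ => Fml.IsRPR φ ∧ Fml.IsRPR ψ
  | .ex _ φ => Fml.IsRPR φ
  | .all _ φ => Fml.IsRPR φ
  | .rpr n Θ _ ψ => (∀ j : Fin n, Fml.IsRPR (Θ j)) ∧ Fml.IsRPR ψ
  | _ => False

/-- MFO(<)-formulas: monadic first-order formulas built from atoms `A(t)`,
`t < t'`, `t = t'` and `t = t' + 1`. -/
def Fml.IsMFO : Fml → Prop
  | .falsum => True
  | .atom _ _ => True
  | .lt _ _ => True
  | .eq _ _ => True
  | .succ _ _ => True
  | .neg φ => Fml.IsMFO φ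
  | .and φ ψ => Fml.IsMFO φ ∧ Fml.IsMFO ψ
  | .or φ ψ => Fml.IsMFO φ ∧ Fml.IsMFO ψ
  | .ex _ φ => Fml.IsMFO φ
  | .all _ φ => Fml.IsMFO φ
  | _ => False

/-- Quasi-positive MFO(<)-formulas: built from atoms `A(t)`, `t < t'`, `t = t'`,
`t = t' + 1` (and ⊥) using ∧, ∨, ∃, ∀ as well as guarded universal quantification
`∀y (x < y < z → φ)`, `∀y (x < y → φ)`, `∀y (y < z → φ)`
(the guarded implications are encoded via `¬guard ∨ φ`). -/
inductive Fml.IsQP : Fml → Prop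
  | falsum : Fml.IsQP .falsum
  | atom (a x : ℕ) : Fml.IsQP (.atom a x)
  | lt (x y : ℕ) : Fml.IsQP (.lt x y)
  | eq (x y : ℕ) : Fml.IsQP (.eq x y)
  | succ (x y : ℕ) : Fml.IsQP (.succ x y)
  | and {φ ψ : Fml} : Fml.IsQP φ → Fml.IsQP ψ → Fml.IsQP (.and φ ψ)
  | or {φ ψ : Fml} : Fml.IsQP φ → Fml.IsQP ψ → Fml.IsQP (.or φ ψ)
  | ex (x : ℕ) {φ : Fml} : Fml.IsQP φ → Fml.IsQP (.ex x φ)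
  | all (x : ℕ) {φ : Fml} : Fml.IsQP φ → Fml.IsQP (.all x φ)
  | allBtw (y x z : ℕ) {φ : Fml} : Fml.IsQP φ →
      Fml.IsQP (.all y (.or (.neg (.and (.lt x y) (.lt y z))) φ))
  | allGt (y x : ℕ) {φ : Fml} : Fml.IsQP φ →
      Fml.IsQP (.all y (.or (.neg (.lt x y)) φ))
  | allLt (y z : ℕ) {φ : Fml} : Fml.IsQP φ →
      Fml.IsQP (.all y (.or (.neg (.lt y z)) φ))

/-- Evaluation in a structure with domain `D` and unary predicates `I`
(no set variables, placeholders or relation variables supplied). -/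
def Fml.evalIn (D : Set ℤ) (I : Itp) (φ : Fml) (env : ℕ → ℤ) : Prop :=
  Fml.eval D I φ env (fun _ => ∅) (fun _ => False) (fun _ _ => False)

/-- An MFO(<)-formula is monotone if it is preserved under adding time points
to the extensions of the atomic concepts. -/
def MonotoneFml (ψ : Fml) : Prop :=
  ∀ M₁ M₂ : Itp, (∀ a : ℕ, M₁ a ⊆ M₂ a) → ∀ env : ℕ → ℤ,
    Fml.evalIn Set.univ M₁ ψ env → Fml.evalIn Set.univ M₂ ψ env

/-! ## The canonical model of a Horn ontology and a data instance -/

/-- Atoms of the closure: ⊥ or `C(n)` for a (basic) temporal concept `C` and `n ∈ ℤ`. -/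
inductive EAtom : Type where
  | bot : EAtom
  | conc : TC → ℤ → EAtom

/-- One (non-recursive) application of the closure rules of the canonical model. -/
def clStep (O : Ontology) (Λ : Set EAtom) : Set EAtom :=
  Λ ∪
  {e | ∃ cl ∈ O, ∃ n : ℤ, (∀ C ∈ cl.prem, EAtom.conc C n ∈ Λ) ∧
        ((∃ C : TC, cl.concl = [C] ∧ e = EAtom.conc C n) ∨
          (cl.concl = [] ∧ e = EAtom.bot))} ∪
  {e | ∃ C : TC, ∃ n k : ℤ, n < k ∧ EAtom.conc (.boxF C) n ∈ Λ ∧ e = EAtom.conc C k} ∪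
  {e | ∃ C : TC, ∃ n : ℤ, (∀ k : ℤ, n < k → EAtom.conc C k ∈ Λ) ∧
        e = EAtom.conc (.boxF C) n} ∪
  {e | ∃ C : TC, ∃ n : ℤ, EAtom.conc (.nextF C) n ∈ Λ ∧ e = EAtom.conc C (n + 1)} ∪
  {e | ∃ C : TC, ∃ n : ℤ, EAtom.conc C (n + 1) ∈ Λ ∧ e = EAtom.conc (.nextF C) n} ∪
  {e | ∃ C : TC, ∃ n k : ℤ, k < n ∧ EAtom.conc (.boxP C) n ∈ Λ ∧ e = EAtom.conc C k} ∪
  {e | ∃ C : TC, ∃ n : ℤ, (∀ k : ℤ, k < n → EAtom.conc C k ∈ Λ) ∧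
        e = EAtom.conc (.boxP C) n} ∪
  {e | ∃ C : TC, ∃ n : ℤ, EAtom.conc (.nextP C) n ∈ Λ ∧ e = EAtom.conc C (n - 1)} ∪
  {e | ∃ C : TC, ∃ n : ℤ, EAtom.conc C (n - 1) ∈ Λ ∧ e = EAtom.conc (.nextP C) n}

/-- Transfinite iteration of the closure rules. -/
noncomputable def clIter (O : Ontology) (Λ : Set EAtom) (o : Ordinal.{0}) : Set EAtom :=
  Ordinal.limitRecOn o Λ (fun _ ih => clStep O ih)
    (fun o _ ih => ⋃ (o' : Ordinal.{0}), ⋃ (h : o' < o), ih o' h)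

/-- The atoms of a data instance, as a set of closure atoms. -/
def dataAtoms (A : DataInstance) : Set EAtom :=
  {e | ∃ p ∈ A.atoms, e = EAtom.conc (.atom p.1) p.2}

open Ordinal in
/-- The canonical model `C_{O,A}`: the closure of `A` under the rules,
iterated up to the first uncountable ordinal ω₁. -/
noncomputable def canon (O : Ontology) (A : DataInstance) : Set EAtom :=
  clIter O (dataAtoms A) (Ordinal.omega 1)

/-- The canonical model regarded as a temporal interpretation. -/
noncomputable def canonItp (O : Ontology) (A : DataInstance) : Itp :=
  fun a => {n | EAtom.conc (.atom a) n ∈ canon O A}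

/-- The type `τ_{O,A}(n)`: the set of subconcepts of `O` that hold at `n`
in the canonical model. -/
noncomputable def tau (O : Ontology) (A : DataInstance) (n : ℤ) : Set TC :=
  {C ∈ O.subs | n ∈ TC.sem (canonItp O A) C}

/-! ## Literals and the reachability relation ⇝ for Krom ontologies -/

/-- A simple literal: an atomic concept with a polarity. -/
abbrev Lit : Type := ℕ × Bool

/-- The temporal concept corresponding to a literal. -/
def Lit.toTC (L : Lit) : TC := if L.2 then .atom L.1 else .neg (.atom L.1)

def TC.iterF : ℕ → TC → TC
  | 0, C => C
  | k + 1, C => .nextF (TC.iterF k C)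

def TC.iterP : ℕ → TC → TC
  | 0, C => C
  | k + 1, C => .nextP (TC.iterP k C)

/-- `○^k C`: `k` occurrences of ○F if `k > 0`, of ○P if `k < 0`. -/
def TC.shift (k : ℤ) (C : TC) : TC :=
  if 0 ≤ k then TC.iterF k.toNat C else TC.iterP (-k).toNat C

/-- `(L₁,n₁) ⇝ (L₂,n₂)`: in every model of `O`,
`(○^{n₁} L₁)^M ⊆ (○^{n₂} L₂)^M`. -/
def leadsTo (O : Ontology) (L₁ : Lit) (n₁ : ℤ) (L₂ : Lit) (n₂ : ℤ) : Prop :=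
  ∀ M : Itp, (∀ cl ∈ O, cl.holds M) →
    TC.sem M (TC.shift n₁ L₁.toTC) ⊆ TC.sem M (TC.shift n₂ L₂.toTC)


/-! ## States at cuts of a temporal interpretation -/

theorem TC.self_mem_subs (C : TC) : C ∈ C.subs := by
  cases C <;> simp [TC.subs]

theorem TC.finite_subs (C : TC) : C.subs.Finite := by
  induction C <;> simp_all [TC.subs]

theorem Ontology.finite_subs (O : Ontology) : O.subs.Finite := by
  have h : O.subs ⊆ ⋃ cl ∈ {cl | cl ∈ O}, ⋃ D ∈ {D | D ∈ cl.prem ++ cl.concl}, D.subs := by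
    rintro C ⟨cl, hcl, D, hD, hC⟩
    simp only [Set.mem_iUnion]
    exact ⟨cl, hcl, D, List.mem_append.2 hD, hC⟩
  refine Set.Finite.subset ?_ h
  refine Set.Finite.biUnion (List.finite_toSet O) fun cl _ => ?_
  exact Set.Finite.biUnion (List.finite_toSet _) fun D _ => D.finite_subs

/-- Box concepts all of whose subconcepts are subconcepts of the ontology. -/
def Ontology.BoxConcept (O : Ontology) (C : TC) : Prop :=
  C.IsBasicBox ∧ C.subs ⊆ O.subs

theorem Ontology.BoxConcept.mem {O : Ontology} {C : TC} (h : O.BoxConcept C) : C ∈ O.subs :=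
  h.2 C.self_mem_subs

/-- Induction over the box concepts of an ontology. -/
theorem Ontology.BoxConcept.induction {O : Ontology} {p : TC → Prop}
    (atom : ∀ b, TC.atom b ∈ O.subs → p (.atom b))
    (boxF : ∀ C, O.BoxConcept C → p C → p (.boxF C))
    (boxP : ∀ C, O.BoxConcept C → p C → p (.boxP C))
    {C : TC} (h : O.BoxConcept C) : p C := by
  obtain ⟨hC, hs⟩ := h
  induction hC with
  | atom b => exact atom b (hs (TC.self_mem_subs _))
  | @boxF C hC ih =>
    have hs' : C.subs ⊆ O.subs := (Set.subset_insert _ _).trans hs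
    exact boxF C ⟨hC, hs'⟩ (ih hs')
  | @boxP C hC ih =>
    have hs' : C.subs ⊆ O.subs := (Set.subset_insert _ _).trans hs
    exact boxP C ⟨hC, hs'⟩ (ih hs')

theorem Ontology.BoolBox.boxConcept {O : Ontology} (hO : O.BoolBox) {cl : Clause} (hcl : cl ∈ O)
    {C : TC} (hC : C ∈ cl.prem ∨ C ∈ cl.concl) : O.BoxConcept C :=
  ⟨hC.elim ((hO cl hcl).1 C) ((hO cl hcl).2 C), fun _ hD => ⟨cl, hcl, C, hC, hD⟩⟩

/-- All clauses of `O` are true in `M`. -/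
def Ontology.HoldsIn (O : Ontology) (M : Itp) : Prop := ∀ cl ∈ O, cl.holds M

/-- An interpretation each of whose points agrees with some point of a model is a model. -/
theorem Ontology.BoolBox.holdsIn_of_pointwise {O : Ontology} (hO : O.BoolBox) {M : Itp}
    (h : ∀ k : ℤ, ∃ M' : Itp, ∃ n : ℤ, O.HoldsIn M' ∧
      ∀ C, O.BoxConcept C → (k ∈ TC.sem M C ↔ n ∈ TC.sem M' C)) : O.HoldsIn M := by
  intro cl hcl k hk
  obtain ⟨M', n, hM', hiff⟩ := h k
  obtain ⟨C, hC, hn⟩ := hM' cl hcl n fun C hC =>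
    (hiff C (hO.boxConcept hcl (.inl hC))).1 (hk C hC)
  exact ⟨C, hC, (hiff C (hO.boxConcept hcl (.inr hC))).2 hn⟩

/-- The finite ordered type of states: which concepts hold everywhere to the left,
and which everywhere to the right, of a cut. -/
abbrev Ontology.State (O : Ontology) : Type :=
  (Set {C // O.BoxConcept C})ᵒᵈ × Set {C // O.BoxConcept C}

instance (O : Ontology) : Finite O.State := by
  have : Finite {C // O.BoxConcept C} := O.finite_subs.subset fun _ hC => Ontology.BoxConcept.mem hC
  have : Finite (Set {C // O.BoxConcept C})ᵒᵈ :=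
    inferInstanceAs (Finite (Set {C // O.BoxConcept C}))
  infer_instance

/-- The state of `M` at the cut between `n` and `n + 1`. -/
def Ontology.state (O : Ontology) (M : Itp) (n : ℤ) : O.State :=
  (OrderDual.toDual {C | ∀ k ≤ n, k ∈ TC.sem M C}, {C | ∀ k, n < k → k ∈ TC.sem M C})

theorem Ontology.state_eq_iff {O : Ontology} {M M' : Itp} {n n' : ℤ} :
    O.state M n = O.state M' n' ↔ ∀ C, O.BoxConcept C →
      ((∀ k ≤ n, k ∈ TC.sem M C) ↔ ∀ k ≤ n', k ∈ TC.sem M' C) ∧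
      ((∀ k, n < k → k ∈ TC.sem M C) ↔ ∀ k, n' < k → k ∈ TC.sem M' C) := by
  simp only [Ontology.state, Prod.ext_iff, OrderDual.toDual_inj, Set.ext_iff, Set.mem_ofPred_eq,
    Subtype.forall, ← forall₂_and]

theorem Ontology.state_mono (O : Ontology) (M : Itp) : Monotone (O.state M) := by
  intro m n hmn
  refine ⟨?_, ?_⟩
  · exact fun C hC k hk => hC k (hk.trans hmn)
  · exact fun C hC k hk => hC k (hmn.trans_lt hk)

/-- Translation of an interpretation along the time line. -/
def Itp.translate (M : Itp) (d : ℤ) : Itp := fun b => {k | k + d ∈ M b}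

theorem Itp.mem_sem_translate {O : Ontology} (M : Itp) (d : ℤ) {C : TC} (hC : O.BoxConcept C) :
    ∀ k, k ∈ TC.sem (M.translate d) C ↔ k + d ∈ TC.sem M C := by
  refine hC.induction (p := fun C => ∀ k, k ∈ TC.sem (M.translate d) C ↔ k + d ∈ TC.sem M C)
    ?_ ?_ ?_
  · exact fun b _ k => Iff.rfl
  · intro C _ ih k
    simp only [TC.sem, Set.mem_ofPred_eq, ih]
    exact ⟨fun h j hj => by simpa using h (j - d) (by lia), fun h j hj => h _ (by lia)⟩
  · intro C _ ih k
    simp only [TC.sem, Set.mem_ofPred_eq, ih]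
    exact ⟨fun h j hj => by simpa using h (j - d) (by lia), fun h j hj => h _ (by lia)⟩

/-- The interpretation that follows `M` up to time `n` and `M'` afterwards. -/
def Itp.glue (M M' : Itp) (n : ℤ) : Itp := fun b => {k | if k ≤ n then k ∈ M b else k ∈ M' b}

theorem Itp.mem_sem_glue {O : Ontology} {M M' : Itp} {n : ℤ} (h : O.state M n = O.state M' n)
    {C : TC} (hC : O.BoxConcept C) :
    ∀ k, k ∈ TC.sem (M.glue M' n) C ↔ if k ≤ n then k ∈ TC.sem M C else k ∈ TC.sem M' C := by
  rw [Ontology.state_eq_iff] at h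
  refine hC.induction (p := fun C => ∀ k, k ∈ TC.sem (M.glue M' n) C ↔
    if k ≤ n then k ∈ TC.sem M C else k ∈ TC.sem M' C) ?_ ?_ ?_
  · exact fun b _ k => Iff.rfl
  · intro C hC ih k
    simp only [TC.sem, Set.mem_ofPred_eq, ih]
    obtain ⟨-, hF⟩ := h C hC
    split_ifs with hk
    · grind
    · exact ⟨fun h j hj => by grind, fun h j hj => by grind⟩
  · intro C hC ih k
    simp only [TC.sem, Set.mem_ofPred_eq, ih]
    obtain ⟨hP, -⟩ := h C hC
    split_ifs with hk
    · exact ⟨fun h j hj => by grind, fun h j hj => by grind⟩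
    · grind

theorem Ontology.BoolBox.holdsIn_translate {O : Ontology} (hO : O.BoolBox) {M : Itp}
    (hM : O.HoldsIn M) (d : ℤ) : O.HoldsIn (M.translate d) :=
  hO.holdsIn_of_pointwise fun k => ⟨M, k + d, hM, fun _ hC => M.mem_sem_translate d hC k⟩

theorem Ontology.state_translate (O : Ontology) (M : Itp) (d n : ℤ) :
    O.state (M.translate d) n = O.state M (n + d) := by
  rw [Ontology.state_eq_iff]
  intro C hC
  simp only [M.mem_sem_translate d hC]
  exact ⟨⟨fun h j hj => by simpa using h (j - d) (by lia), fun h j hj => h _ (by lia)⟩,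
    ⟨fun h j hj => by simpa using h (j - d) (by lia), fun h j hj => h _ (by lia)⟩⟩

theorem Ontology.BoolBox.holdsIn_glue {O : Ontology} (hO : O.BoolBox) {M M' : Itp} {n : ℤ}
    (hM : O.HoldsIn M) (hM' : O.HoldsIn M') (h : O.state M n = O.state M' n) :
    O.HoldsIn (M.glue M' n) := by
  refine hO.holdsIn_of_pointwise fun k => ?_
  by_cases hk : k ≤ n
  · exact ⟨M, k, hM, fun C hC => by rw [Itp.mem_sem_glue h hC, if_pos hk]⟩
  · exact ⟨M', k, hM', fun C hC => by rw [Itp.mem_sem_glue h hC, if_neg hk]⟩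

theorem Ontology.state_glue_of_le {O : Ontology} {M M' : Itp} {n m : ℤ}
    (h : O.state M n = O.state M' n) (hm : m ≤ n) : O.state (M.glue M' n) m = O.state M m := by
  have h' := Ontology.state_eq_iff.1 h
  rw [Ontology.state_eq_iff]
  intro C hC
  simp only [Itp.mem_sem_glue h hC]
  obtain ⟨hP, hF⟩ := h' C hC
  refine ⟨?_, ?_⟩
  · grind
  · exact ⟨fun h j hj => by grind, fun h j hj => by grind⟩

/-! ## Existence of models as runs over the data -/

/-- The atomic concepts relevant to the query `(O, a)`. -/
def Ontology.relevant (O : Ontology) (a : ℕ) : Set ℕ := {b | b = a ∨ TC.atom b ∈ O.subs}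

theorem Ontology.finite_relevant (O : Ontology) (a : ℕ) : (O.relevant a).Finite :=
  (Set.finite_singleton a).union
    (O.finite_subs.preimage (f := TC.atom) fun _ _ _ _ h => by simpa using h)

/-- The point `n` of `M` respects the data about the point `y`, and refutes `a` if `y = ℓ`. -/
def Ontology.Fits (O : Ontology) (a : ℕ) (I : Itp) (ℓ y : ℤ) (M : Itp) (n : ℤ) : Prop :=
  (∀ b ∈ O.relevant a, y ∈ I b → n ∈ M b) ∧ (y = ℓ → n ∉ M a)

/-- Some model of `O` passes from state `q` to state `q'` over a point fitting the data at `y`. -/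
def Ontology.Step (O : Ontology) (a : ℕ) (I : Itp) (ℓ : ℤ) (q q' : O.State) (y : ℤ) : Prop :=
  ∃ M : Itp, ∃ n : ℤ, O.HoldsIn M ∧ O.state M (n - 1) = q ∧ O.state M n = q' ∧
    O.Fits a I ℓ y M n

/-- The state `q` occurs in some model of `O`. -/
def Ontology.Realized (O : Ontology) (q : O.State) : Prop :=
  ∃ M : Itp, ∃ n : ℤ, O.HoldsIn M ∧ O.state M n = q

/-- Some model of `O` is in state `q` after `x` and fits the data after `x` and up to `N`. -/
def Ontology.Run (O : Ontology) (a : ℕ) (I : Itp) (ℓ N : ℤ) (q : O.State) (x : ℤ) : Prop :=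
  ∃ M : Itp, O.HoldsIn M ∧ O.state M x = q ∧ ∀ y, x < y → y ≤ N → O.Fits a I ℓ y M y

section Run

variable {O : Ontology} {a : ℕ} {I : Itp} {ℓ N : ℤ}

theorem Ontology.Step.le {q q' : O.State} {y : ℤ} (h : O.Step a I ℓ q q' y) : q ≤ q' := by
  obtain ⟨M, n, -, rfl, rfl, -⟩ := h
  exact O.state_mono M (by lia)

theorem Ontology.BoolBox.run_self_iff (hO : O.BoolBox) {q : O.State} :
    O.Run a I ℓ N q N ↔ O.Realized q := by
  constructor
  · rintro ⟨M, hM, hq, -⟩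
    exact ⟨M, N, hM, hq⟩
  · rintro ⟨M, n, hM, rfl⟩
    refine ⟨M.translate (n - N), hO.holdsIn_translate hM _, ?_, fun y h h' => by lia⟩
    rw [O.state_translate, add_sub_cancel]

theorem Ontology.BoolBox.run_iff_step (hO : O.BoolBox) {q : O.State} {x y : ℤ} (hxy : y = x + 1)
    (hy : y ≤ N) : O.Run a I ℓ N q x ↔ ∃ q', O.Step a I ℓ q q' y ∧ O.Run a I ℓ N q' y := by
  subst hxy
  constructor
  · rintro ⟨M, hM, rfl, hfit⟩
    refine ⟨O.state M (x + 1), ⟨M, x + 1, hM, by simp, rfl, hfit _ (by lia) hy⟩, M, hM, rfl, ?_⟩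
    exact fun z hz hz' => hfit z (by lia) hz'
  · rintro ⟨q', ⟨M, n, hM, rfl, rfl, hfit⟩, M', hM', hst, hfit'⟩
    have hst' : O.state (M.translate (n - (x + 1))) (x + 1) = O.state M' (x + 1) := by
      rw [O.state_translate, hst, add_sub_cancel]
    refine ⟨(M.translate (n - (x + 1))).glue M' (x + 1),
      hO.holdsIn_glue (hO.holdsIn_translate hM _) hM' hst', ?_, fun z hz hz' => ?_⟩
    · rw [O.state_glue_of_le hst' (by lia), O.state_translate]
      congr 1
      ring
    · by_cases h : z = x + 1
      · subst h
        simpa [Ontology.Fits, Itp.glue, Itp.translate] using hfit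
      · have h1 : ¬ z ≤ x + 1 := by lia
        simpa [Ontology.Fits, Itp.glue, Itp.translate, h1] using hfit' z (by lia) hz'

theorem Ontology.BoolBox.run_of_loop (hO : O.BoolBox) {q : O.State} {x y : ℤ} (hxy : x ≤ y)
    (hy : y ≤ N) (hrun : O.Run a I ℓ N q y) (hloop : ∀ z, x < z → z ≤ y → O.Step a I ℓ q q z) :
    O.Run a I ℓ N q x := by
  induction x, hxy using Int.leInductionDown with
  | base => exact hrun
  | pred x hx ih =>
    refine (hO.run_iff_step (y := x) (by lia) (by lia)).2
      ⟨q, hloop x (by lia) hx, ih fun z hz hz' => hloop z (by lia) hz'⟩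

/-- A run either stays in its state forever or loops until it moves to a larger state. -/
theorem Ontology.BoolBox.run_iff (hO : O.BoolBox) {q : O.State} {x : ℤ} (hx : x ≤ N) :
    O.Run a I ℓ N q x ↔
      (O.Realized q ∧ ∀ z ≤ N, x < z → O.Step a I ℓ q q z) ∨
      ∃ y ≤ N, x < y ∧ (∀ z ≤ N, x < z → z < y → O.Step a I ℓ q q z) ∧
        ∃ q', q < q' ∧ O.Step a I ℓ q q' y ∧ O.Run a I ℓ N q' y := by
  constructor
  · intro h
    induction x, hx using Int.leInductionDown with
    | base => exact .inl ⟨hO.run_self_iff.1 h, fun z hz hz' => by lia⟩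
    | pred x hx ih =>
      obtain ⟨q', hstep, hrun⟩ := (hO.run_iff_step (y := x) (by lia) hx).1 h
      rcases hstep.le.eq_or_lt with rfl | hlt
      · have key : ∀ z, x - 1 < z → z = x ∨ x < z := fun z hz => by lia
        rcases ih hrun with ⟨hq, hloop⟩ | ⟨y, hy, hxy, hloop, hnext⟩
        · refine .inl ⟨hq, fun z hz hz' => ?_⟩
          rcases key z hz' with rfl | hz'
          exacts [hstep, hloop z hz hz']
        · refine .inr ⟨y, hy, by lia, fun z hz hz' hzy => ?_, hnext⟩
          rcases key z hz' with rfl | hz'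
          exacts [hstep, hloop z hz hz' hzy]
      · exact .inr ⟨x, hx, by lia, fun z _ hz hz' => by lia, q', hlt, hstep, hrun⟩
  · rintro (⟨hq, hloop⟩ | ⟨y, hy, hxy, hloop, q', -, hstep, hrun⟩)
    · exact hO.run_of_loop hx le_rfl (hO.run_self_iff.2 hq) fun z hz hz' => hloop z hz' hz
    · have h : O.Run a I ℓ N q (y - 1) :=
        (hO.run_iff_step (y := y) (by lia) hy).2 ⟨q', hstep, hrun⟩
      exact hO.run_of_loop (y := y - 1) (by lia) (by lia) h fun z hz hz' =>
        hloop z (by lia) hz (by lia)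

end Run

/-! ## Relations definable by `FO(<)`-formulas over finite intervals -/

/-- The relation `R` is defined, on each interval `[m, N]`, by a single `FO(<)`-formula
with free variables in `S`. -/
def FOltDefinable (S : Set ℕ) (R : ℤ → ℤ → Itp → (ℕ → ℤ) → Prop) : Prop :=
  ∃ φ : Fml, φ.IsFOlt ∧ φ.fvars ⊆ S ∧ ∀ m N I env, (∀ i ∈ S, env i ∈ Set.Icc m N) →
    (φ.evalIn (Set.Icc m N) I env ↔ R m N I env)

namespace FOltDefinable

variable {S : Set ℕ} {R R' : ℤ → ℤ → Itp → (ℕ → ℤ) → Prop}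

theorem congr (h : FOltDefinable S R)
    (hR : ∀ m N I env, (∀ i ∈ S, env i ∈ Set.Icc m N) → (R m N I env ↔ R' m N I env)) :
    FOltDefinable S R' := by
  obtain ⟨φ, h₁, h₂, h₃⟩ := h
  exact ⟨φ, h₁, h₂, fun m N I env he => (h₃ m N I env he).trans (hR m N I env he)⟩

theorem mono {T : Set ℕ} (h : FOltDefinable S R) (hST : S ⊆ T) : FOltDefinable T R := by
  obtain ⟨φ, h₁, h₂, h₃⟩ := h
  exact ⟨φ, h₁, h₂.trans hST, fun m N I env he => h₃ m N I env fun i hi => he i (hST hi)⟩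

theorem not (h : FOltDefinable S R) : FOltDefinable S fun m N I env => ¬ R m N I env := by
  obtain ⟨φ, h₁, h₂, h₃⟩ := h
  exact ⟨φ.neg, h₁, h₂, fun m N I env he => not_congr (h₃ m N I env he)⟩

theorem and (h : FOltDefinable S R) (h' : FOltDefinable S R') :
    FOltDefinable S fun m N I env => R m N I env ∧ R' m N I env := by
  obtain ⟨φ, h₁, h₂, h₃⟩ := h
  obtain ⟨ψ, k₁, k₂, k₃⟩ := h'
  exact ⟨φ.and ψ, ⟨h₁, k₁⟩, Set.union_subset h₂ k₂,
    fun m N I env he => and_congr (h₃ m N I env he) (k₃ m N I env he)⟩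

theorem imp (h : FOltDefinable S R) (h' : FOltDefinable S R') :
    FOltDefinable S fun m N I env => R m N I env → R' m N I env :=
  (h.and h'.not).not.congr fun m N I env _ => by tauto

theorem or (h : FOltDefinable S R) (h' : FOltDefinable S R') :
    FOltDefinable S fun m N I env => R m N I env ∨ R' m N I env :=
  (h.not.and h'.not).not.congr fun m N I env _ => by tauto

theorem const (p : Prop) : FOltDefinable S fun _ _ _ _ => p := by
  by_cases hp : p
  · exact ⟨.neg .falsum, trivial, Set.empty_subset _, fun _ _ _ _ _ => by
      simp [Fml.evalIn, Fml.eval, hp]⟩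
  · exact ⟨.falsum, trivial, Set.empty_subset _, fun _ _ _ _ _ => by
      simp [Fml.evalIn, Fml.eval, hp]⟩

theorem exists_finite {ι : Type*} [Finite ι] {R : ι → ℤ → ℤ → Itp → (ℕ → ℤ) → Prop}
    (h : ∀ i, FOltDefinable S (R i)) :
    FOltDefinable S fun m N I env => ∃ i, R i m N I env := by
  have key : ∀ s : Set ι, s.Finite →
      FOltDefinable S fun m N I env => ∃ i ∈ s, R i m N I env := by
    intro s hs
    induction s, hs using Set.Finite.induction_on with
    | empty => simpa using const (S := S) False
    | insert _ _ ih => simpa [Set.mem_insert_iff, or_and_right, exists_or] using (h _).or ih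
  simpa using key Set.univ Set.finite_univ

theorem forall_finite {ι : Type*} [Finite ι] {R : ι → ℤ → ℤ → Itp → (ℕ → ℤ) → Prop}
    (h : ∀ i, FOltDefinable S (R i)) :
    FOltDefinable S fun m N I env => ∀ i, R i m N I env :=
  (exists_finite fun i => (h i).not).not.congr fun m N I env _ => by simp

theorem exists_mem (x : ℕ) (h : FOltDefinable (insert x S) R) :
    FOltDefinable S fun m N I env => ∃ d ∈ Set.Icc m N, R m N I (Function.update env x d) := by
  obtain ⟨φ, h₁, h₂, h₃⟩ := h
  refine ⟨φ.ex x, h₁, fun i hi => (h₂ hi.1).resolve_left hi.2, fun m N I env he => ?_⟩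
  refine exists_congr fun d => and_congr_right fun hd => h₃ m N I _ fun i hi => ?_
  by_cases hix : i = x
  · simpa [hix] using hd
  · simpa [hix] using he i (hi.resolve_left hix)

theorem forall_mem (x : ℕ) (h : FOltDefinable (insert x S) R) :
    FOltDefinable S fun m N I env => ∀ d ∈ Set.Icc m N, R m N I (Function.update env x d) :=
  (exists_mem x h.not).not.congr fun m N I env _ => by simp

theorem lt {x y : ℕ} (hx : x ∈ S) (hy : y ∈ S) :
    FOltDefinable S fun _ _ _ env => env x < env y :=
  ⟨.lt x y, trivial, Set.pair_subset hx hy, fun _ _ _ _ _ => Iff.rfl⟩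

theorem eq {x y : ℕ} (hx : x ∈ S) (hy : y ∈ S) :
    FOltDefinable S fun _ _ _ env => env x = env y :=
  ⟨.eq x y, trivial, Set.pair_subset hx hy, fun _ _ _ _ _ => Iff.rfl⟩

theorem atom (b : ℕ) {x : ℕ} (hx : x ∈ S) : FOltDefinable S fun _ _ I env => env x ∈ I b :=
  ⟨.atom b x, trivial, Set.singleton_subset_iff.2 hx, fun _ _ _ _ _ => Iff.rfl⟩

theorem step (O : Ontology) (a : ℕ) (q q' : O.State) {x : ℕ} (h0 : 0 ∈ S) (hx : x ∈ S) :
    FOltDefinable S fun _ _ I env => O.Step a I (env 0) q q' (env x) := by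
  have : Finite (O.relevant a) := O.finite_relevant a
  have ha : a ∈ O.relevant a := .inl rfl
  have key := exists_finite (S := S) fun X : Set (O.relevant a) =>
    (const (S := S) (∃ M : Itp, ∃ n : ℤ, O.HoldsIn M ∧ O.state M (n - 1) = q ∧
      O.state M n = q' ∧ ∀ b : O.relevant a, n ∈ M b ↔ b ∈ X)).and
    ((forall_finite fun b : O.relevant a => (atom (S := S) b hx).imp (const (b ∈ X))).and
      ((eq hx h0).imp (const (⟨a, ha⟩ ∉ X))))
  refine key.congr fun m N I env _ => ⟨?_, ?_⟩
  · rintro ⟨X, ⟨M, n, hM, hq, hq', hX⟩, hI, hℓ⟩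
    exact ⟨M, n, hM, hq, hq', fun b hb hI' => (hX ⟨b, hb⟩).2 (hI ⟨b, hb⟩ hI'),
      fun h hn => hℓ h ((hX ⟨a, ha⟩).1 hn)⟩
  · rintro ⟨M, n, hM, hq, hq', hI, hℓ⟩
    exact ⟨{b | n ∈ M b}, ⟨M, n, hM, hq, hq', fun b => Iff.rfl⟩, fun b hb => hI b b.2 hb, hℓ⟩

theorem run {O : Ontology} (hO : O.BoolBox) (a : ℕ) (q : O.State) :
    ∀ x : ℕ, x ≠ 0 → FOltDefinable {0, x} fun _ N I env => O.Run a I (env 0) N q (env x) := by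
  induction q using WellFoundedGT.induction with
  | ind q ih =>
    intro x hx
    have stay := (const (S := {0, x}) (O.Realized q)).and <|
      forall_mem (x + 1) <| (lt (x := x) (y := x + 1) (by simp) (by simp)).imp
        (step O a q q (x := x + 1) (by simp) (by simp))
    have loop := forall_mem (S := insert (x + 1) {0, x}) (x + 2) <|
      (lt (x := x) (y := x + 2) (by simp) (by simp)).imp <|
        (lt (x := x + 2) (y := x + 1) (by simp) (by simp)).imp
          (step O a q q (x := x + 2) (by simp) (by simp))
    have move := exists_finite (S := insert (x + 1) {0, x}) fun q' : {q' // q < q'} =>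
      (step O a q q' (x := x + 1) (by simp) (by simp)).and
        ((ih q' q'.2 (x + 1) (by simp)).mono (by
          rintro i (rfl | rfl) <;> simp))
    have leave := exists_mem (S := {0, x}) (x + 1) <|
      (lt (x := x) (y := x + 1) (by simp) (by simp)).and (loop.and move)
    refine (stay.or leave).congr fun m N I env he => ?_
    have hxI : env x ∈ Set.Icc m N := he x (by simp)
    rw [hO.run_iff hxI.2]
    have hlt : ∀ d, env x < d → m ≤ d := fun d hd => hxI.1.trans hd.le
    refine or_congr (and_congr_right fun _ => ?_) ?_
    · simp
      grind
    · simp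
      grind

/-- Existence of a model of `O` fitting the data and refuting `a` at the point `env 0`. -/
theorem exists_fits {O : Ontology} (hO : O.BoolBox) (a : ℕ) :
    FOltDefinable {0} fun m N I env =>
      ∃ M, O.HoldsIn M ∧ ∀ y ∈ Set.Icc m N, O.Fits a I (env 0) y M y := by
  have first := forall_mem (S := insert 1 {0}) 2 (lt (x := 2) (y := 1) (by simp) (by simp)).not
  have go := exists_finite (S := insert 1 {0}) fun q : O.State × O.State =>
    (step O a q.1 q.2 (x := 1) (by simp) (by simp)).and
      ((run hO a q.2 1 one_ne_zero).mono (by rintro i (rfl | rfl) <;> simp))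
  refine (exists_mem 1 (first.and go)).congr fun m N I env he => ?_
  have hm : m ≤ N := (he 0 rfl).1.trans (he 0 rfl).2
  trans ∃ q, O.Run a I (env 0) N q (m - 1)
  · simp only [hO.run_iff_step (sub_add_cancel m 1).symm hm]
    constructor
    · rintro ⟨d, hd, hmin, ⟨q, q'⟩, hq⟩
      obtain rfl : d = m := le_antisymm (by simpa using hmin m ⟨le_rfl, hm⟩) hd.1
      exact ⟨q, q', by simpa using hq⟩
    · rintro ⟨q, q', hq⟩
      exact ⟨m, ⟨le_rfl, hm⟩, fun d hd => by simpa using hd.1, (q, q'), by simpa using hq⟩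
  · constructor
    · rintro ⟨q, M, hM, -, h⟩
      exact ⟨M, hM, fun y hy => h y (by grind) hy.2⟩
    · rintro ⟨M, hM, h⟩
      exact ⟨_, M, hM, rfl, fun y hy hy' => h y ⟨by lia, hy'⟩⟩

end FOltDefinable

theorem Ontology.BoolBox.isModel_extend {O : Ontology} (hO : O.BoolBox) {a : ℕ} {M : Itp}
    (hM : O.HoldsIn M) {M' : Itp} (h : ∀ b ∈ O.relevant a, M' b = M b) : O.HoldsIn M' := by
  refine hO.holdsIn_of_pointwise fun k => ⟨M, k, hM, fun C hC => ?_⟩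
  have hC : TC.sem M' C = TC.sem M C := by
    refine hC.induction (p := fun C => TC.sem M' C = TC.sem M C) ?_ ?_ ?_
    · exact fun b hb => h b (.inr hb)
    · exact fun C _ ih => by simp only [TC.sem, ih]
    · exact fun C _ ih => by simp only [TC.sem, ih]
  rw [hC]

theorem DataInstance.mem_tem (A : DataInstance) {p : ℕ × ℤ} (hp : p ∈ A.atoms) : p.2 ∈ A.tem :=
  ⟨Finset.min'_le _ _ (Finset.mem_image_of_mem _ hp),
    Finset.le_max' _ _ (Finset.mem_image_of_mem _ hp)⟩

/-- A point of the active domain is not a certain answer iff some model fits the data around it. -/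
theorem Ontology.BoolBox.exists_fits_iff {O : Ontology} (hO : O.BoolBox) (a : ℕ)
    (A : DataInstance) {ℓ : ℤ} (hℓ : ℓ ∈ A.tem) :
    (∃ M, O.HoldsIn M ∧ ∀ y ∈ A.tem, O.Fits a A.itp ℓ y M y) ↔
      ∃ M, IsModel M O A ∧ ℓ ∉ M a := by
  classical
  constructor
  · rintro ⟨M, hM, hfit⟩
    have ha : a ∈ O.relevant a := .inl rfl
    refine ⟨fun b => if b ∈ O.relevant a then M b else Set.univ,
      ⟨hO.isModel_extend hM fun b hb => if_pos hb, fun p hp => ?_⟩, ?_⟩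
    · by_cases hb : p.1 ∈ O.relevant a
      · simpa [hb] using (hfit p.2 (A.mem_tem hp)).1 p.1 hb hp
      · simp [hb]
    · simpa [ha] using (hfit ℓ hℓ).2 rfl
  · rintro ⟨M, hM, hMa⟩
    exact ⟨M, hM.1, fun y _ => ⟨fun b _ hb => hM.2 (b, y) hb, fun h => h ▸ hMa⟩⟩

/-- FO(<)-rewritability of LTL_bool^□ OMAQs. -/
theorem boolBox_OMAQ_FOlt_rewritable (O : Ontology) (hO : O.BoolBox) (a : ℕ) :
    ∃ φ : Fml, φ.IsFOlt ∧ φ.fvars ⊆ {0} ∧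
      ∀ A : DataInstance,
        certAns O (.atom a) A = {ℓ ∈ A.tem | Fml.evalIn A.tem A.itp φ (fun _ => ℓ)} := by
  obtain ⟨φ, hφ, hvars, h⟩ := (FOltDefinable.exists_fits hO a).not
  refine ⟨φ, hφ, hvars, fun A => ?_⟩
  ext ℓ
  refine and_congr_right fun hℓ => ?_
  refine Iff.trans ?_ (h A.minT A.maxT A.itp (fun _ => ℓ) fun _ _ => hℓ).symm
  rw [← not_exists_not]
  simp only [Classical.not_imp]
  exact not_congr (hO.exists_fits_iff a A hℓ).symm

end LTLOMQ
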